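/- arXiv:1008.5216 — 6 statements merged into one kernel-verified Lean document; each statement's English description precedes it below -/
import Mathlib

section
/- Let k be a field, n ≥ 1, and let F_1,…,F_n be k-vector spaces of dimension r and G_1,…,G_n be k-vector spaces of dimension m. Suppose the linear maps satisfy: (I) f'_i ∘ f_i = 0, f_i ∘ f'_i = 0, g'_i ∘ g_i = 0, and g_i ∘ g'_i = 0 for all 1 ≤ i ≤ n−1; (II) ker g_i = range g'_i and ker g'_i = range g_i for all 1 ≤ i ≤ n−1; (III) for all 1 ≤ i ≤ n−2, range g_i is a complement of ker g_{i+1} in G_{i+1} and range g'_{i+1} is a complement of ker g'_i in G_{i+1}. Then the subspace of ∏_{i=1}^n Hom_k(F_i, G_i) consisting of linked tuples has dimension r·m. -/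
/-!
Linked Hom spaces (Osserman, "Linked Hom spaces").

We index the chains `F_1, …, F_n` and `G_1, …, G_n` of the paper by
`0, …, n-1`, so the maps `f_i : F_i → F_{i+1}` (for `1 ≤ i ≤ n-1` in the
paper) become `f i : F i →ₗ F (i+1)` for `i` with `i + 2 ≤ n`, etc.
-/

open LinearMap Module

/-- The space of linked tuples `(φ_1, …, φ_n)`, `φ_i : F_i → G_i`, satisfying
`φ_{i+1} ∘ f_i = g_i ∘ φ_i` and `φ_i ∘ f'_i = g'_i ∘ φ_{i+1}`, as a submodule
of `∏_{i=1}^n Hom(F_i, G_i)`. -/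
def linkedTuples (k : Type*) [CommRing k] (n : ℕ) (F G : ℕ → Type*)
    [∀ i, AddCommGroup (F i)] [∀ i, Module k (F i)]
    [∀ i, AddCommGroup (G i)] [∀ i, Module k (G i)]
    (f : ∀ i, F i →ₗ[k] F (i + 1)) (f' : ∀ i, F (i + 1) →ₗ[k] F i)
    (g : ∀ i, G i →ₗ[k] G (i + 1)) (g' : ∀ i, G (i + 1) →ₗ[k] G i) :
    Submodule k (∀ i : Fin n, F i →ₗ[k] G i) where
  carrier := {φ | ∀ i : ℕ, ∀ h : i + 2 ≤ n,
    (φ ⟨i + 1, by omega⟩).comp (f i) = (g i).comp (φ ⟨i, by omega⟩) ∧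
    (φ ⟨i, by omega⟩).comp (f' i) = (g' i).comp (φ ⟨i + 1, by omega⟩)}
  add_mem' := by
    intro a b ha hb i h
    obtain ⟨ha1, ha2⟩ := ha i h
    obtain ⟨hb1, hb2⟩ := hb i h
    constructor
    · simp only [Pi.add_apply, LinearMap.add_comp, LinearMap.comp_add, ha1, hb1]
    · simp only [Pi.add_apply, LinearMap.add_comp, LinearMap.comp_add, ha2, hb2]
  zero_mem' := by
    intro i h
    exact ⟨by simp, by simp⟩
  smul_mem' := by
    intro c a ha i h
    obtain ⟨ha1, ha2⟩ := ha i h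
    constructor
    · simp only [Pi.smul_apply, LinearMap.smul_comp, LinearMap.comp_smul, ha1]
    · simp only [Pi.smul_apply, LinearMap.smul_comp, LinearMap.comp_smul, ha2]

section Helpers

variable {k : Type*} [Field k] {F G : ℕ → Type*}
  [∀ i, AddCommGroup (F i)] [∀ i, Module k (F i)]
  [∀ i, AddCommGroup (G i)] [∀ i, Module k (G i)]
  {U V : Type*} [AddCommGroup U] [Module k U] [AddCommGroup V] [Module k V]

/-- A linear map out of the `N`-th space of a chain pulls back compatibly to all earlier spaces. -/
lemma exists_compatible_pullback (f : ∀ i, F i →ₗ[k] F (i + 1)) (N : ℕ) (P : F N →ₗ[k] U) :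
    ∃ p : ∀ i, F i →ₗ[k] U, p N = P ∧ ∀ i < N, p i = (p (i + 1)).comp (f i) := by
  induction N with
  | zero =>
    exact ⟨Function.update (fun _ => 0) 0 P, by simp, fun i hi => absurd hi (by omega)⟩
  | succ N ih =>
    obtain ⟨p, hpN, hp⟩ := ih (P.comp (f N))
    refine ⟨Function.update p (N + 1) P, by simp, fun i hi => ?_⟩
    rw [Function.update_of_ne (by omega)]
    rcases Nat.lt_succ_iff_lt_or_eq.mp hi with h | rfl
    · rw [Function.update_of_ne (by omega), hp i h]
    · rw [Function.update_self, hpN]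

/-- A linear map out of the first space of a backward chain pulls back compatibly to all later
spaces. -/
def backwardPullback (f' : ∀ i, F (i + 1) →ₗ[k] F i) (Q : F 0 →ₗ[k] V) : ∀ i, F i →ₗ[k] V
  | 0 => Q
  | i + 1 => (backwardPullback f' Q i).comp (f' i)

/-- If the chain `G` splits into constant chains `U` (where `g` is the identity) and `V` (where
`g'` is the identity), then a linked tuple amounts to a map from the last space of `F` to `U` and
a map from the first space of `F` to `V`. -/
lemma nonempty_linkedTuples_equiv (N : ℕ)
    (f : ∀ i, F i →ₗ[k] F (i + 1)) (f' : ∀ i, F (i + 1) →ₗ[k] F i)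
    (g : ∀ i, G i →ₗ[k] G (i + 1)) (g' : ∀ i, G (i + 1) →ₗ[k] G i)
    (hI : ∀ i < N, (f' i).comp (f i) = 0 ∧ (f i).comp (f' i) = 0 ∧
      (g' i).comp (g i) = 0 ∧ (g i).comp (g' i) = 0)
    (p : ∀ i, G i →ₗ[k] U) (q : ∀ i, G i →ₗ[k] V)
    (hp : ∀ i < N, p i = (p (i + 1)).comp (g i))
    (hq : ∀ i < N, q (i + 1) = (q i).comp (g' i))
    (hbij : ∀ i ≤ N, Function.Bijective ((p i).prod (q i))) :
    Nonempty (linkedTuples k (N + 1) F G f f' g g' ≃ₗ[k] (F N →ₗ[k] U) × (F 0 →ₗ[k] V)) := by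
  have hext : ∀ i ≤ N, ∀ x y : G i, p i x = p i y → q i x = q i y → x = y := fun i hi x y h1 h2 =>
    (hbij i hi).1 (Prod.ext h1 h2)
  have hp' : ∀ i < N, ∀ x, p (i + 1) (g i x) = p i x := fun i hi x => by simp [hp i hi]
  have hq' : ∀ i < N, ∀ x, q i (g' i x) = q (i + 1) x := fun i hi x => by simp [hq i hi]
  have hpg : ∀ i < N, ∀ x, p i (g' i x) = 0 := fun i hi x => by
    rw [← hp' i hi, ← LinearMap.comp_apply (g i), (hI i hi).2.2.2]; simp
  have hqg : ∀ i < N, ∀ x, q (i + 1) (g i x) = 0 := fun i hi x => by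
    rw [← hq' i hi, ← LinearMap.comp_apply (g' i), (hI i hi).2.2.1]; simp
  let T : (∀ i : Fin (N + 1), F i →ₗ[k] G i) →ₗ[k] (F N →ₗ[k] U) × (F 0 →ₗ[k] V) :=
    { toFun := fun φ => ((p N).comp (φ ⟨N, by omega⟩), (q 0).comp (φ ⟨0, by omega⟩))
      map_add' := fun a b => Prod.ext (LinearMap.comp_add _ _ _) (LinearMap.comp_add _ _ _)
      map_smul' := fun c a => Prod.ext (LinearMap.comp_smul _ _ _) (LinearMap.comp_smul _ _ _) }
  refine ⟨LinearEquiv.ofBijective (T.comp (linkedTuples k (N + 1) F G f f' g g').subtype)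
    ⟨?_, ?_⟩⟩
  · rw [injective_iff_map_eq_zero]
    rintro ⟨φ, hφ⟩ h0
    have h0P : (p N).comp (φ ⟨N, by omega⟩) = 0 := congrArg Prod.fst h0
    have h0Q : (q 0).comp (φ ⟨0, by omega⟩) = 0 := congrArg Prod.snd h0
    have hP : ∀ i (hi : i ≤ N), (p i).comp (φ ⟨i, by omega⟩) = 0 := by
      intro i hi
      induction hi using Nat.decreasingInduction with
      | self => exact h0P
      | of_succ j hj ih =>
        rw [hp j hj, LinearMap.comp_assoc, ← (hφ j (by omega)).1, ← LinearMap.comp_assoc, ih,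
          LinearMap.zero_comp]
    have hQ : ∀ i (hi : i ≤ N), (q i).comp (φ ⟨i, by omega⟩) = 0 := by
      intro i hi
      induction i with
      | zero => exact h0Q
      | succ j ih =>
        rw [hq j hi, LinearMap.comp_assoc, ← (hφ j (by omega)).2, ← LinearMap.comp_assoc,
          ih (by omega), LinearMap.zero_comp]
    ext ⟨i, hi⟩ x
    refine hext i (by omega) _ _ ?_ ?_
    · simpa using LinearMap.congr_fun (hP i (by omega)) x
    · simpa using LinearMap.congr_fun (hQ i (by omega)) x
  · rintro ⟨α, β⟩
    obtain ⟨a, haN, ha⟩ := exists_compatible_pullback f N α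
    let b := backwardPullback f' β
    let e : ∀ i : Fin (N + 1), G i ≃ₗ[k] U × V := fun i =>
      LinearEquiv.ofBijective ((p i).prod (q i)) (hbij i (by omega))
    let φ : ∀ i : Fin (N + 1), F i →ₗ[k] G i := fun i =>
      (e i).symm.toLinearMap.comp ((a i).prod (b i))
    have hφ : ∀ i (hi : i ≤ N) x, (p i (φ ⟨i, by omega⟩ x), q i (φ ⟨i, by omega⟩ x))
        = (a i x, b i x) := fun i hi x =>
      (e ⟨i, by omega⟩).apply_symm_apply (a i x, b i x)
    have hpφ : ∀ i (hi : i ≤ N) x, p i (φ ⟨i, by omega⟩ x) = a i x := fun i hi x =>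
      congrArg Prod.fst (hφ i hi x)
    have hqφ : ∀ i (hi : i ≤ N) x, q i (φ ⟨i, by omega⟩ x) = b i x := fun i hi x =>
      congrArg Prod.snd (hφ i hi x)
    have ha' : ∀ i < N, ∀ x, a (i + 1) (f i x) = a i x := fun i hi x => by simp [ha i hi]
    have hb' : ∀ i x, b (i + 1) x = b i (f' i x) := fun i x => rfl
    have hff : ∀ i < N, ∀ x, f' i (f i x) = 0 := fun i hi x =>
      LinearMap.congr_fun (hI i hi).1 x
    have hff' : ∀ i < N, ∀ x, f i (f' i x) = 0 := fun i hi x =>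
      LinearMap.congr_fun (hI i hi).2.1 x
    refine ⟨⟨φ, fun i hi => ⟨?_, ?_⟩⟩, ?_⟩
    · ext x
      refine hext (i + 1) (by omega) _ _ ?_ ?_
      · simp only [LinearMap.comp_apply]
        rw [hpφ (i + 1) (by omega), hp' i (by omega), hpφ i (by omega), ha' i (by omega)]
      · simp only [LinearMap.comp_apply]
        rw [hqφ (i + 1) (by omega), hqg i (by omega), hb', hff i (by omega), map_zero]
    · ext x
      refine hext i (by omega) _ _ ?_ ?_
      · simp only [LinearMap.comp_apply]
        rw [hpφ i (by omega), hpg i (by omega), ← ha' i (by omega), hff' i (by omega), map_zero]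
      · simp only [LinearMap.comp_apply]
        rw [hqφ i (by omega), hq' i (by omega), hqφ (i + 1) (by omega), hb']
    · refine Prod.ext ?_ ?_
      · ext x
        exact (hpφ N le_rfl x).trans (by rw [haN])
      · ext x
        exact hqφ 0 (by omega) x

/-- An exact chain with complementary images splits into two constant chains, as in
`nonempty_linkedTuples_equiv`. -/
lemma exists_splitting (N m : ℕ)
    (hGfin : ∀ i ≤ N + 1, FiniteDimensional k (G i)) (hGm : ∀ i ≤ N + 1, finrank k (G i) = m)
    (g : ∀ i, G i →ₗ[k] G (i + 1)) (g' : ∀ i, G (i + 1) →ₗ[k] G i)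
    (hII : ∀ i ≤ N, ker (g i) = range (g' i) ∧ ker (g' i) = range (g i))
    (hIII : ∀ i < N, IsCompl (range (g i)) (ker (g (i + 1))) ∧
      IsCompl (range (g' (i + 1))) (ker (g' i))) :
    ∃ (p : ∀ i, G i →ₗ[k] range (g N)) (q : ∀ i, G i →ₗ[k] ker (g 0)),
      (∀ i < N + 1, p i = (p (i + 1)).comp (g i)) ∧
      (∀ i < N + 1, q (i + 1) = (q i).comp (g' i)) ∧
      (∀ i ≤ N + 1, Function.Bijective ((p i).prod (q i))) := by
  obtain ⟨P, hP⟩ := (range (g N)).subtype.exists_leftInverse_of_injective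
    (Submodule.ker_subtype _)
  obtain ⟨Q, hQ⟩ := (ker (g 0)).subtype.exists_leftInverse_of_injective (Submodule.ker_subtype _)
  have hP' : ∀ x (hx : x ∈ range (g N)), P x = ⟨x, hx⟩ := fun x hx =>
    LinearMap.congr_fun hP ⟨x, hx⟩
  have hQ' : ∀ x (hx : x ∈ ker (g 0)), Q x = ⟨x, hx⟩ := fun x hx =>
    LinearMap.congr_fun hQ ⟨x, hx⟩
  obtain ⟨p, hpN, hp⟩ := exists_compatible_pullback g (N + 1) P
  let q := backwardPullback g' Q
  have hpker : ∀ i ≤ N, ker (p i) = ker (g i) ∧ Function.Surjective (p i) := by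
    intro i hi
    induction hi using Nat.decreasingInduction with
    | self =>
      have h : p N = (g N).rangeRestrict := by
        rw [hp N (by omega), hpN]
        ext x
        simp [hP' (g N x) ⟨x, rfl⟩]
      rw [h]
      exact ⟨LinearMap.ker_rangeRestrict _, LinearMap.surjective_rangeRestrict _⟩
    | of_succ j hj ih =>
      obtain ⟨hk, hs⟩ := ih
      have hc := (hIII j hj).1
      rw [hp j (by omega)]
      constructor
      · rw [LinearMap.ker_comp, hk]
        ext x
        refine ⟨fun hx => ?_, fun hx => by simp [LinearMap.mem_ker.mp hx]⟩
        exact Submodule.disjoint_def.mp hc.disjoint _ ⟨x, rfl⟩ hx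
      · intro u
        obtain ⟨y, rfl⟩ := hs u
        obtain ⟨_, ⟨x, rfl⟩, z, hz, rfl⟩ := Submodule.mem_sup.mp
          (hc.sup_eq_top ▸ Submodule.mem_top : y ∈ range (g j) ⊔ ker (g (j + 1)))
        rw [← hk] at hz
        exact ⟨x, by simp [LinearMap.mem_ker.mp hz]⟩
  have hqker : ∀ i ≤ N, ker (q (i + 1)) = ker (g' i) := by
    intro i hi
    induction i with
    | zero =>
      ext x
      have hx : g' 0 x ∈ ker (g 0) := (hII 0 hi).1 ▸ ⟨x, rfl⟩
      have h : q 1 x = ⟨g' 0 x, hx⟩ := hQ' _ hx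
      simp [h]
    | succ j ih =>
      have h : q (j + 1 + 1) = (q (j + 1)).comp (g' (j + 1)) := rfl
      rw [h, LinearMap.ker_comp, ih (by omega)]
      ext x
      refine ⟨fun hx => ?_, fun hx => by simp [LinearMap.mem_ker.mp hx]⟩
      exact Submodule.disjoint_def.mp (hIII j hi).2.disjoint _ ⟨x, rfl⟩ hx
  have hdim : finrank k (range (g N)) + finrank k (ker (g 0)) = m := by
    have := hGfin 0 (by omega)
    have h := LinearMap.finrank_range_add_finrank_ker (p 0)
    obtain ⟨hk, hs⟩ := hpker 0 (by omega)
    rwa [hk, LinearMap.range_eq_top.mpr hs, finrank_top, hGm 0 (by omega)] at h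
  have hdisj : ∀ i ≤ N + 1, ∀ x, p i x = 0 → q i x = 0 → x = 0 := by
    intro i hi x hpx hqx
    rcases i with _ | i
    · have hx : x ∈ ker (g 0) := (hpker 0 (by omega)).1 ▸ hpx
      have h : q 0 x = ⟨x, hx⟩ := hQ' x hx
      exact congrArg Subtype.val (h.symm.trans hqx)
    · have hx : x ∈ ker (g' i) := hqker i (by omega) ▸ hqx
      rcases Nat.lt_or_ge i N with h | h
      · have hx' : x ∈ ker (g (i + 1)) := (hpker (i + 1) h).1 ▸ hpx
        rw [(hII i (by omega)).2] at hx
        exact Submodule.disjoint_def.mp (hIII i h).1.disjoint x hx hx'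
      · obtain rfl : i = N := by omega
        rw [(hII i le_rfl).2] at hx
        rw [hpN, hP' x hx] at hpx
        exact congrArg Subtype.val hpx
  refine ⟨p, q, hp, fun i _ => rfl, fun i hi => ?_⟩
  have := hGfin i hi
  have := hGfin 0 (by omega)
  have := hGfin (N + 1) le_rfl
  have hinj : Function.Injective ((p i).prod (q i)) := by
    rw [injective_iff_map_eq_zero]
    intro x hx
    exact hdisj i hi x (congrArg Prod.fst hx) (congrArg Prod.snd hx)
  refine ⟨hinj, (LinearMap.injective_iff_surjective_of_finrank_eq_finrank ?_).mp hinj⟩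
  rw [finrank_prod, hdim, hGm i hi]

/-- The dimension count for a chain `G` that splits into two constant chains. -/
lemma finrank_linkedTuples_of_splitting (N r m : ℕ)
    [FiniteDimensional k U] [FiniteDimensional k V]
    (hFfin : ∀ i ≤ N, FiniteDimensional k (F i)) (hFr : ∀ i ≤ N, finrank k (F i) = r)
    (hGm : finrank k (G 0) = m)
    (f : ∀ i, F i →ₗ[k] F (i + 1)) (f' : ∀ i, F (i + 1) →ₗ[k] F i)
    (g : ∀ i, G i →ₗ[k] G (i + 1)) (g' : ∀ i, G (i + 1) →ₗ[k] G i)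
    (hI : ∀ i < N, (f' i).comp (f i) = 0 ∧ (f i).comp (f' i) = 0 ∧
      (g' i).comp (g i) = 0 ∧ (g i).comp (g' i) = 0)
    (p : ∀ i, G i →ₗ[k] U) (q : ∀ i, G i →ₗ[k] V)
    (hp : ∀ i < N, p i = (p (i + 1)).comp (g i))
    (hq : ∀ i < N, q (i + 1) = (q i).comp (g' i))
    (hbij : ∀ i ≤ N, Function.Bijective ((p i).prod (q i))) :
    finrank k (linkedTuples k (N + 1) F G f f' g g') = r * m := by
  obtain ⟨e⟩ := nonempty_linkedTuples_equiv N f f' g g' hI p q hp hq hbij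
  have := hFfin 0 (by omega)
  have := hFfin N le_rfl
  rw [e.finrank_eq, finrank_prod, finrank_linearMap, finrank_linearMap, hFr 0 (by omega),
    hFr N le_rfl, ← mul_add, ← finrank_prod,
    ← (LinearEquiv.ofBijective _ (hbij 0 (by omega))).finrank_eq, hGm]

end Helpers

/-- over a field `k`, with `dim F_i = r`, `dim G_i = m`, and
conditions (I) (with `s = 0`), (II) and (III), the space of linked tuples has
dimension `r * m`. -/
theorem linkedTuples_finrank_eq (k : Type*) [Field k] (n : ℕ) (hn : 1 ≤ n) (r m : ℕ)
    (F G : ℕ → Type*)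
    [∀ i, AddCommGroup (F i)] [∀ i, Module k (F i)]
    [∀ i, AddCommGroup (G i)] [∀ i, Module k (G i)]
    (hFfin : ∀ i, i < n → FiniteDimensional k (F i))
    (hGfin : ∀ i, i < n → FiniteDimensional k (G i))
    (hFr : ∀ i, i < n → finrank k (F i) = r)
    (hGm : ∀ i, i < n → finrank k (G i) = m)
    (f : ∀ i, F i →ₗ[k] F (i + 1)) (f' : ∀ i, F (i + 1) →ₗ[k] F i)
    (g : ∀ i, G i →ₗ[k] G (i + 1)) (g' : ∀ i, G (i + 1) →ₗ[k] G i)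
    -- condition (I), with `s = 0`:
    (hI : ∀ i, i + 2 ≤ n → (f' i).comp (f i) = 0 ∧ (f i).comp (f' i) = 0 ∧
      (g' i).comp (g i) = 0 ∧ (g i).comp (g' i) = 0)
    -- condition (II): kernels equal images
    (hII : ∀ i, i + 2 ≤ n → ker (g i) = range (g' i) ∧ ker (g' i) = range (g i))
    -- condition (III): complementarity
    (hIII : ∀ i, i + 3 ≤ n →
      IsCompl (range (g i)) (ker (g (i + 1))) ∧
      IsCompl (range (g' (i + 1))) (ker (g' i))) :
    finrank k (linkedTuples k n F G f f' g g') = r * m := by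
  obtain ⟨N, rfl⟩ : ∃ N, n = N + 1 := ⟨n - 1, by omega⟩
  have hFfin' : ∀ i ≤ N, FiniteDimensional k (F i) := fun i hi => hFfin i (by omega)
  have hFr' : ∀ i ≤ N, finrank k (F i) = r := fun i hi => hFr i (by omega)
  have hI' := fun i (hi : i < N) => hI i (by omega)
  rcases N with _ | N
  · have := hGfin 0 (by omega)
    obtain ⟨p, hp0, hp⟩ := exists_compatible_pullback g 0 (LinearMap.id (R := k) (M := G 0))
    refine finrank_linkedTuples_of_splitting (V := PUnit.{1}) 0 r m hFfin' hFr' (hGm 0 (by omega))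
      f f' g g' hI' p (fun _ => 0) hp (fun _ _ => by simp) fun i hi => ?_
    obtain rfl : i = 0 := by omega
    rw [hp0]
    exact ⟨fun x y h => congrArg Prod.fst h, fun y => ⟨y.1, rfl⟩⟩
  · obtain ⟨p, q, hp, hq, hbij⟩ := exists_splitting N m (fun i hi => hGfin i (by omega))
      (fun i hi => hGm i (by omega)) g g' (fun i hi => hII i (by omega))
      (fun i hi => hIII i (by omega))
    have := hGfin 0 (by omega)
    have := hGfin (N + 1) (by omega)
    exact finrank_linkedTuples_of_splitting (N + 1) r m hFfin' hFr' (hGm 0 (by omega))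
      f f' g g' hI' p q hp hq hbij
end

section
/- Let R be a commutative ring, s ∈ R a unit, n ≥ 1, and let F_1,…,F_n and G_1,…,G_n be R-modules with R-linear maps f_i : F_i → F_{i+1}, f'_i : F_{i+1} → F_i, g_i : G_i → G_{i+1}, g'_i : G_{i+1} → G_i (1 ≤ i ≤ n−1) satisfying f_i ∘ f'_i = f'_i ∘ f_i = s·id, g_i ∘ g'_i = g'_i ∘ g_i = s·id. Then the map sending a linked tuple (φ_1,…,φ_n) to φ_1 is an R-linear isomorphism from the R-module of linked tuples onto Hom_R(F_1, G_1). -/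
/-!
Linked Hom spaces (Osserman, "Linked Hom spaces").

We index the chains `F_1, …, F_n` and `G_1, …, G_n` of the paper by
`0, …, n-1`, so the maps `f_i : F_i → F_{i+1}` (for `1 ≤ i ≤ n-1` in the
paper) become `f i : F i →ₗ F (i+1)` for `i` with `i + 2 ≤ n`, etc.
-/

open LinearMap Module

/-- The family of maps `F i → G i` obtained from `φ : F 0 → G 0` by the recursion
`φ_{i+1} = t • (g_i ∘ φ_i ∘ f'_i)`. -/
def linkedExtension {R : Type*} [CommRing R] {F G : ℕ → Type*}
    [∀ i, AddCommGroup (F i)] [∀ i, Module R (F i)]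
    [∀ i, AddCommGroup (G i)] [∀ i, Module R (G i)]
    (t : R) (f' : ∀ i, F (i + 1) →ₗ[R] F i) (g : ∀ i, G i →ₗ[R] G (i + 1))
    (φ : F 0 →ₗ[R] G 0) : ∀ i, F i →ₗ[R] G i
  | 0 => φ
  | i + 1 => t • (g i).comp ((linkedExtension t f' g φ i).comp (f' i))

/-- if `s` is a unit, the map sending a linked tuple
`(φ_1, …, φ_n)` to `φ_1` is an `R`-linear isomorphism from the module of
linked tuples onto `Hom_R(F_1, G_1)`. -/
theorem linkedTuples_equiv_hom_of_isUnit (R : Type*) [CommRing R] (s : R) (hs : IsUnit s)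
    (n : ℕ) (hn : 1 ≤ n)
    (F G : ℕ → Type*)
    [∀ i, AddCommGroup (F i)] [∀ i, Module R (F i)]
    [∀ i, AddCommGroup (G i)] [∀ i, Module R (G i)]
    (f : ∀ i, F i →ₗ[R] F (i + 1)) (f' : ∀ i, F (i + 1) →ₗ[R] F i)
    (g : ∀ i, G i →ₗ[R] G (i + 1)) (g' : ∀ i, G (i + 1) →ₗ[R] G i)
    (hf : ∀ i, i + 2 ≤ n → (f i).comp (f' i) = s • LinearMap.id ∧
      (f' i).comp (f i) = s • LinearMap.id)
    (hg : ∀ i, i + 2 ≤ n → (g i).comp (g' i) = s • LinearMap.id ∧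
      (g' i).comp (g i) = s • LinearMap.id) :
    ∃ e : linkedTuples R n F G f f' g g' ≃ₗ[R] (F 0 →ₗ[R] G 0),
      ∀ φ : linkedTuples R n F G f f' g g',
        e φ = (φ : ∀ i : Fin n, F i →ₗ[R] G i) ⟨0, by omega⟩ := by
  obtain ⟨t, hts⟩ := hs.exists_left_inv
  let ev : linkedTuples R n F G f f' g g' →ₗ[R] (F 0 →ₗ[R] G 0) :=
    (LinearMap.proj (R := R) (φ := fun i : Fin n => F i →ₗ[R] G i) ⟨0, hn⟩).comp
      (linkedTuples R n F G f f' g g').subtype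
  have hinj : Function.Injective ev := by
    intro φ ψ h
    have key : ∀ i (hi : i < n), φ.1 ⟨i, hi⟩ = ψ.1 ⟨i, hi⟩ := by
      intro i
      induction i with
      | zero => exact fun _ => h
      | succ i ih =>
        intro hi
        have h1 := (φ.2 i hi).1
        have h2 := (ψ.2 i hi).1
        rw [ih (by omega), ← h2] at h1
        have h3 := congrArg (fun u => t • u.comp (f' i)) h1
        simpa only [LinearMap.comp_assoc, (hf i hi).1, LinearMap.comp_smul, smul_smul, hts,
          one_smul, LinearMap.comp_id] using h3
    exact Subtype.ext (funext fun i => key i i.2)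
  have hsurj : Function.Surjective ev := by
    intro φ
    refine ⟨⟨fun i => linkedExtension t f' g φ i, fun i hi => ⟨?_, ?_⟩⟩, rfl⟩
    · simp only [linkedExtension, LinearMap.smul_comp, LinearMap.comp_assoc, (hf i hi).2,
        LinearMap.comp_smul, smul_smul, hts, one_smul, LinearMap.comp_id]
    · simp only [linkedExtension, LinearMap.comp_smul]
      rw [← LinearMap.comp_assoc, (hg i hi).2, LinearMap.smul_comp, smul_smul, hts, one_smul,
        LinearMap.id_comp]
  exact ⟨LinearEquiv.ofBijective ev ⟨hinj, hsurj⟩, fun _ => rfl⟩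
end

section
/- Let R be a commutative ring, s ∈ R, n ≥ 1, and let F_1,…,F_n and G_1,…,G_n be R-modules with R-linear maps f_i, f'_i, g_i, g'_i (1 ≤ i ≤ n−1) satisfying f_i ∘ f'_i = f'_i ∘ f_i = s·id and g_i ∘ g'_i = g'_i ∘ g_i = s·id. Suppose each G_i has an internal direct sum decomposition G_i = G'_i ⊕ G''_i such that g_i(G'_i) ⊆ G'_{i+1}, g_i(G''_i) ⊆ G''_{i+1}, g'_i(G'_{i+1}) ⊆ G'_i, g'_i(G''_{i+1}) ⊆ G''_i, and such that the map G'_i → G'_{i+1} induced by g_i and the map G''_{i+1} → G''_i induced by g'_i are isomorphisms for all 1 ≤ i ≤ n−1. Then the map sending a linked tuple (φ_1,…,φ_n) to (π''_1 ∘ φ_1, π'_n ∘ φ_n), where π''_1 : G_1 → G''_1 and π'_n : G_n → G'_n are the projections determined by the decompositions, is an R-linear isomorphism from the R-module of linked tuples onto Hom_R(F_1, G''_1) × Hom_R(F_n, G'_n). -/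
/-!
Linked Hom spaces (Osserman, "Linked Hom spaces").

We index the chains `F_1, …, F_n` and `G_1, …, G_n` of the paper by
`0, …, n-1`, so the maps `f_i : F_i → F_{i+1}` (for `1 ≤ i ≤ n-1` in the
paper) become `f i : F i →ₗ F (i+1)` for `i` with `i + 2 ≤ n`, etc.
-/

open LinearMap Module

/-- If each `h' i` is bijective, any map `F 0 → H 0` extends upwards to a linked family. -/
theorem exists_linked_of_bijective_backward {R : Type*} [CommRing R] {s : R} {F H : ℕ → Type*}
    [∀ i, AddCommGroup (F i)] [∀ i, Module R (F i)]
    [∀ i, AddCommGroup (H i)] [∀ i, Module R (H i)]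
    (f : ∀ i, F i →ₗ[R] F (i + 1)) (f' : ∀ i, F (i + 1) →ₗ[R] F i) (m : ℕ)
    (h : ∀ i, i < m → (H i →ₗ[R] H (i + 1))) (h' : ∀ i, i < m → (H (i + 1) →ₗ[R] H i))
    (hf : ∀ i, i < m → ∀ x, f' i (f i x) = s • x)
    (hh : ∀ i (hi : i < m), ∀ x, h' i hi (h i hi x) = s • x)
    (hbij : ∀ i (hi : i < m), Function.Bijective (h' i hi)) (ψ : F 0 →ₗ[R] H 0) :
    ∃ φ : ∀ i, F i →ₗ[R] H i, φ 0 = ψ ∧ ∀ i (hi : i < m),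
      (∀ x, φ (i + 1) (f i x) = h i hi (φ i x)) ∧
      (∀ x, φ i (f' i x) = h' i hi (φ (i + 1) x)) := by
  induction m with
  | zero => exact ⟨Function.update 0 0 ψ, by simp, by simp⟩
  | succ m ih =>
    obtain ⟨φ, h0, hφ⟩ := ih (fun i hi => h i (by omega)) (fun i hi => h' i (by omega))
      (fun i hi => hf i (by omega)) (fun i hi => hh i (by omega)) (fun i hi => hbij i (by omega))
    let e := LinearEquiv.ofBijective (h' m (by omega)) (hbij m (by omega))
    have he : ∀ x, h' m (by omega) (e.symm x) = x := e.apply_symm_apply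
    refine ⟨Function.update φ (m + 1) (e.symm.toLinearMap ∘ₗ φ m ∘ₗ f' m), ?_, ?_⟩
    · rw [Function.update_of_ne (by omega), h0]
    · intro i hi
      rw [Function.update_of_ne (show i ≠ m + 1 by omega)]
      obtain hlt | rfl : i < m ∨ i = m := by omega
      · rw [Function.update_of_ne (show i + 1 ≠ m + 1 by omega)]
        exact hφ i hlt
      · rw [Function.update_self]
        refine ⟨fun x => (hbij i hi).1 ?_, fun x => ?_⟩
        · simp [he, hf i hi, hh i hi]
        · simp [he]

/-- If each `h i` is bijective, any map `F m → H m` extends downwards to a linked family. -/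
theorem exists_linked_of_bijective_forward {R : Type*} [CommRing R] {s : R} {F H : ℕ → Type*}
    [∀ i, AddCommGroup (F i)] [∀ i, Module R (F i)]
    [∀ i, AddCommGroup (H i)] [∀ i, Module R (H i)]
    (f : ∀ i, F i →ₗ[R] F (i + 1)) (f' : ∀ i, F (i + 1) →ₗ[R] F i) (m : ℕ)
    (h : ∀ i, i < m → (H i →ₗ[R] H (i + 1))) (h' : ∀ i, i < m → (H (i + 1) →ₗ[R] H i))
    (hf : ∀ i, i < m → ∀ x, f i (f' i x) = s • x)
    (hh : ∀ i (hi : i < m), ∀ x, h i hi (h' i hi x) = s • x)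
    (hbij : ∀ i (hi : i < m), Function.Bijective (h i hi)) (ψ : F m →ₗ[R] H m) :
    ∃ φ : ∀ i, F i →ₗ[R] H i, φ m = ψ ∧ ∀ i (hi : i < m),
      (∀ x, φ (i + 1) (f i x) = h i hi (φ i x)) ∧
      (∀ x, φ i (f' i x) = h' i hi (φ (i + 1) x)) := by
  induction m with
  | zero => exact ⟨Function.update 0 0 ψ, by simp, by simp⟩
  | succ m ih =>
    let e := LinearEquiv.ofBijective (h m (by omega)) (hbij m (by omega))
    have he : ∀ x, h m (by omega) (e.symm x) = x := e.apply_symm_apply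
    obtain ⟨φ, hm, hφ⟩ := ih (fun i hi => h i (by omega)) (fun i hi => h' i (by omega))
      (fun i hi => hf i (by omega)) (fun i hi => hh i (by omega)) (fun i hi => hbij i (by omega))
      (e.symm.toLinearMap ∘ₗ ψ ∘ₗ f m)
    refine ⟨Function.update φ (m + 1) ψ, Function.update_self .., ?_⟩
    intro i hi
    rw [Function.update_of_ne (show i ≠ m + 1 by omega)]
    obtain hlt | rfl : i < m ∨ i = m := by omega
    · rw [Function.update_of_ne (show i + 1 ≠ m + 1 by omega)]
      exact hφ i hlt
    · rw [Function.update_self, hm]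
      refine ⟨fun x => ?_, fun x => (hbij i hi).1 ?_⟩
      · simp [he]
      · simp [he, hf i hi, hh i hi]

/-- A map respecting two decompositions and injective on the second summand reflects membership
in the first summand. -/
theorem LinearMap.mem_of_apply_mem_of_isCompl {R M N : Type*} [CommRing R]
    [AddCommGroup M] [Module R M] [AddCommGroup N] [Module R N] (T : M →ₗ[R] N)
    {p q : Submodule R M} {p' q' : Submodule R N} (hpq : Codisjoint p q) (hpq' : Disjoint p' q')
    (hp : ∀ x ∈ p, T x ∈ p') (hq : ∀ x ∈ q, T x ∈ q')
    (hinj : Function.Injective (T.restrict hq)) {y : M} (hy : T y ∈ p') : y ∈ p := by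
  obtain ⟨a, b, ha, hb, rfl⟩ := Submodule.codisjoint_iff_exists_add_eq.mp hpq y
  have hb' : T b ∈ p' := by simpa using p'.sub_mem hy (hp a ha)
  have hb0 : T b = 0 := Submodule.disjoint_def.mp hpq' _ hb' (hq b hb)
  have : (⟨b, hb⟩ : q) = 0 := hinj (by ext; simpa using hb0)
  have : b = 0 := congrArg Subtype.val this
  simpa [this] using ha

/-- with decompositions `G_i = G'_i ⊕ G''_i` preserved by the
`g`-maps, such that the induced maps `G'_i → G'_{i+1}` and `G''_{i+1} → G''_i`
are isomorphisms, the map `(φ_1, …, φ_n) ↦ (π''_1 ∘ φ_1, π'_n ∘ φ_n)` is an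
`R`-linear isomorphism onto `Hom(F_1, G''_1) × Hom(F_n, G'_n)`. -/
theorem linkedTuples_equiv_of_decomposition (R : Type*) [CommRing R] (s : R)
    (n : ℕ) (hn : 1 ≤ n)
    (F G : ℕ → Type*)
    [∀ i, AddCommGroup (F i)] [∀ i, Module R (F i)]
    [∀ i, AddCommGroup (G i)] [∀ i, Module R (G i)]
    (f : ∀ i, F i →ₗ[R] F (i + 1)) (f' : ∀ i, F (i + 1) →ₗ[R] F i)
    (g : ∀ i, G i →ₗ[R] G (i + 1)) (g' : ∀ i, G (i + 1) →ₗ[R] G i)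
    (hf : ∀ i, i + 2 ≤ n → (f i).comp (f' i) = s • LinearMap.id ∧
      (f' i).comp (f i) = s • LinearMap.id)
    (hg : ∀ i, i + 2 ≤ n → (g i).comp (g' i) = s • LinearMap.id ∧
      (g' i).comp (g i) = s • LinearMap.id)
    -- the internal direct sum decompositions `G_i = G'_i ⊕ G''_i`:
    (G₁ G₂ : ∀ i, Submodule R (G i))
    (hcompl : ∀ i, i < n → IsCompl (G₁ i) (G₂ i))
    -- the `g`-maps preserve the decompositions:
    (hgG₁ : ∀ i (_ : i + 2 ≤ n), ∀ x ∈ G₁ i, g i x ∈ G₁ (i + 1))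
    (hgG₂ : ∀ i (_ : i + 2 ≤ n), ∀ x ∈ G₂ i, g i x ∈ G₂ (i + 1))
    (hg'G₁ : ∀ i (_ : i + 2 ≤ n), ∀ x ∈ G₁ (i + 1), g' i x ∈ G₁ i)
    (hg'G₂ : ∀ i (_ : i + 2 ≤ n), ∀ x ∈ G₂ (i + 1), g' i x ∈ G₂ i)
    -- the induced maps `G'_i → G'_{i+1}` and `G''_{i+1} → G''_i` are isomorphisms:
    (hgbij : ∀ i (h : i + 2 ≤ n), Function.Bijective ((g i).restrict (hgG₁ i h)))
    (hg'bij : ∀ i (h : i + 2 ≤ n), Function.Bijective ((g' i).restrict (hg'G₂ i h))) :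
    ∃ e : linkedTuples R n F G f f' g g' ≃ₗ[R]
        ((F 0 →ₗ[R] G₂ 0) × (F (n - 1) →ₗ[R] G₁ (n - 1))),
      ∀ φ : linkedTuples R n F G f f' g g',
        e φ =
          (((G₂ 0).linearProjOfIsCompl (G₁ 0) (hcompl 0 (by omega)).symm).comp
              ((φ : ∀ i : Fin n, F i →ₗ[R] G i) ⟨0, by omega⟩),
            ((G₁ (n - 1)).linearProjOfIsCompl (G₂ (n - 1)) (hcompl (n - 1) (by omega))).comp
              ((φ : ∀ i : Fin n, F i →ₗ[R] G i) ⟨n - 1, by omega⟩)) := by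
  obtain ⟨m, rfl⟩ : ∃ m, n = m + 1 := ⟨n - 1, by omega⟩
  let π₂ := (G₂ 0).projectionOnto (G₁ 0) (hcompl 0 (by omega)).symm
  let π₁ := (G₁ m).projectionOnto (G₂ m) (hcompl m (by omega))
  let L : linkedTuples R (m + 1) F G f f' g g' →ₗ[R]
      ((F 0 →ₗ[R] G₂ 0) × (F m →ₗ[R] G₁ m)) :=
    { toFun := fun φ => (π₂ ∘ₗ φ.1 ⟨0, by omega⟩, π₁ ∘ₗ φ.1 ⟨m, by omega⟩)
      map_add' := fun a b => Prod.ext (LinearMap.comp_add _ _ π₂) (LinearMap.comp_add _ _ π₁)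
      map_smul' := fun c a => Prod.ext (π₂.comp_smul _ _) (π₁.comp_smul _ _) }
  have hL : Function.Bijective L := by
    constructor
    · rw [injective_iff_map_eq_zero]
      rintro ⟨φ, hφ⟩ h0
      have h2 : π₂ ∘ₗ φ ⟨0, by omega⟩ = 0 := congrArg Prod.fst h0
      have h1 : π₁ ∘ₗ φ ⟨m, by omega⟩ = 0 := congrArg Prod.snd h0
      have key1 : ∀ i (hi : i < m + 1), ∀ x, φ ⟨i, hi⟩ x ∈ G₁ i := by
        intro i
        induction i with
        | zero =>
          intro hi x
          exact (Submodule.projectionOnto_apply_eq_zero_iff _).mp (LinearMap.congr_fun h2 x)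
        | succ i ih =>
          intro hi x
          refine (g' i).mem_of_apply_mem_of_isCompl (hcompl (i + 1) hi).codisjoint
            (hcompl i (by omega)).disjoint (hg'G₁ i (by omega)) (hg'G₂ i (by omega))
            (hg'bij i (by omega)).1 ?_
          have := LinearMap.congr_fun (hφ i (by omega)).2 x
          simp only [LinearMap.comp_apply] at this
          rw [← this]
          exact ih (by omega) _
      have key2 : ∀ i (hi : i ≤ m), ∀ x : F i, φ ⟨i, Nat.lt_succ_of_le hi⟩ x ∈ G₂ i := by
        intro i hi
        induction hi using Nat.decreasingInduction with
        | self =>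
          intro x
          exact (Submodule.projectionOnto_apply_eq_zero_iff _).mp (LinearMap.congr_fun h1 x)
        | of_succ i hi ih =>
          intro x
          refine (g i).mem_of_apply_mem_of_isCompl (hcompl i (by omega)).symm.codisjoint
            (hcompl (i + 1) (by omega)).symm.disjoint (hgG₂ i (by omega)) (hgG₁ i (by omega))
            (hgbij i (by omega)).1 ?_
          have := LinearMap.congr_fun (hφ i (by omega)).1 x
          simp only [LinearMap.comp_apply] at this
          rw [← this]
          exact ih _
      refine Subtype.ext (funext fun i => LinearMap.ext fun x => ?_)
      exact Submodule.disjoint_def.mp (hcompl i i.2).disjoint _ (key1 i i.2 x)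
        (key2 i (by omega) x)
    · rintro ⟨ψ₂, ψ₁⟩
      obtain ⟨α, hα0, hα⟩ := exists_linked_of_bijective_backward (H := fun i => G₂ i) (s := s)
        f f' m (fun i hi => (g i).restrict (hgG₂ i (by omega)))
        (fun i hi => (g' i).restrict (hg'G₂ i (by omega)))
        (fun i hi x => LinearMap.congr_fun (hf i (by omega)).2 x)
        (fun i hi x => Subtype.ext (LinearMap.congr_fun (hg i (by omega)).2 x))
        (fun i hi => hg'bij i (by omega)) ψ₂
      obtain ⟨β, hβm, hβ⟩ := exists_linked_of_bijective_forward (H := fun i => G₁ i) (s := s)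
        f f' m (fun i hi => (g i).restrict (hgG₁ i (by omega)))
        (fun i hi => (g' i).restrict (hg'G₁ i (by omega)))
        (fun i hi x => LinearMap.congr_fun (hf i (by omega)).1 x)
        (fun i hi x => Subtype.ext (LinearMap.congr_fun (hg i (by omega)).1 x))
        (fun i hi => hgbij i (by omega)) ψ₁
      refine ⟨⟨fun i => (G₂ i).subtype ∘ₗ α i + (G₁ i).subtype ∘ₗ β i, ?_⟩, ?_⟩
      · intro i hi
        constructor <;> ext x
        · simp [(hα i (by omega)).1, (hβ i (by omega)).1]
        · simp [(hα i (by omega)).2, (hβ i (by omega)).2]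
      · refine Prod.ext (LinearMap.ext fun x => ?_) (LinearMap.ext fun x => ?_)
        · change π₂ (α 0 x + β 0 x) = ψ₂ x
          simp [π₂, hα0]
        · change π₁ (α m x + β m x) = ψ₁ x
          simp [π₁, hβm]
  exact ⟨LinearEquiv.ofBijective L hL, fun φ => rfl⟩
end

section
/- Let k be a field, n ≥ 1, and let G_1,…,G_n be finite-dimensional k-vector spaces of dimension m with linear maps g_i : G_i → G_{i+1}, g'_i : G_{i+1} → G_i (1 ≤ i ≤ n−1) satisfying: g'_i ∘ g_i = 0 and g_i ∘ g'_i = 0 for all i; ker g_i = range g'_i and ker g'_i = range g_i for all i; and for all 1 ≤ i ≤ n−2, range g_i is a complement of ker g_{i+1} in G_{i+1} and range g'_{i+1} is a complement of ker g'_i in G_{i+1}. Then there exist subspaces G'_i, G''_i of G_i for each 1 ≤ i ≤ n such that G_i = G'_i ⊕ G''_i is an internal direct sum, g_i maps G'_i isomorphically onto G'_{i+1}, g'_i maps G''_{i+1} isomorphically onto G''_i, g_i(G''_i) = 0, and g'_i(G'_{i+1}) = 0, for all 1 ≤ i ≤ n−1. -/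
/-!
Statement 4 (structure lemma over a field, `s = 0` case of Lemma 2.4 of
Osserman, "Linked Hom spaces").  The chain `G_1, …, G_n` of the paper is
indexed here by `0, …, n-1`, so the maps `g_i : G_i → G_{i+1}`
(`1 ≤ i ≤ n-1` in the paper) become `g i : G i →ₗ G (i+1)` for `i + 2 ≤ n`.
-/

open LinearMap Module

theorem LinearMap.map_eq_range_of_isCompl_ker {R M N : Type*} [Ring R] [AddCommGroup M]
    [AddCommGroup N] [Module R M] [Module R N] {f : M →ₗ[R] N} {p : Submodule R M}
    (h : IsCompl p (ker f)) : Submodule.map f p = range f := by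
  rw [range_eq_map, ← h.sup_eq_top, Submodule.map_sup,
    LinearMap.le_ker_iff_map.1 le_rfl, sup_bot_eq]

theorem exists_decomposition_of_linked_chain_field (k : Type*) [Field k]
    (n : ℕ) (hn : 1 ≤ n) (m : ℕ)
    (G : ℕ → Type*) [∀ i, AddCommGroup (G i)] [∀ i, Module k (G i)]
    (hGfin : ∀ i, i < n → FiniteDimensional k (G i))
    (hGm : ∀ i, i < n → finrank k (G i) = m)
    (g : ∀ i, G i →ₗ[k] G (i + 1)) (g' : ∀ i, G (i + 1) →ₗ[k] G i)
    -- `g'_i ∘ g_i = 0` and `g_i ∘ g'_i = 0`: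
    (hzero : ∀ i, i + 2 ≤ n → (g' i).comp (g i) = 0 ∧ (g i).comp (g' i) = 0)
    -- kernels equal images:
    (hker : ∀ i, i + 2 ≤ n → ker (g i) = range (g' i) ∧ ker (g' i) = range (g i))
    -- complementarity:
    (hcompl : ∀ i, i + 3 ≤ n →
      IsCompl (range (g i)) (ker (g (i + 1))) ∧
      IsCompl (range (g' (i + 1))) (ker (g' i))) :
    ∃ G₁ G₂ : ∀ i, Submodule k (G i),
      (∀ i, i < n → IsCompl (G₁ i) (G₂ i)) ∧
      (∀ i, i + 2 ≤ n →
        -- `g_i` maps `G'_i` isomorphically onto `G'_{i+1}`: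
        Submodule.map (g i) (G₁ i) = G₁ (i + 1) ∧
        Set.InjOn (g i) (G₁ i) ∧
        -- `g'_i` maps `G''_{i+1}` isomorphically onto `G''_i`:
        Submodule.map (g' i) (G₂ (i + 1)) = G₂ i ∧
        Set.InjOn (g' i) (G₂ (i + 1)) ∧
        -- `g_i(G''_i) = 0` and `g'_i(G'_{i+1}) = 0`:
        Submodule.map (g i) (G₂ i) = ⊥ ∧
        Submodule.map (g' i) (G₁ (i + 1)) = ⊥) := by
  obtain ⟨C, hC⟩ := Submodule.exists_isCompl (ker (g 0))
  let G₁ : ∀ i, Submodule k (G i)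
    | 0 => C
    | i + 1 => range (g i)
  choose D hD using fun i => Submodule.exists_isCompl (G₁ i)
  let G₂ : ∀ i, Submodule k (G i) := fun i => if i + 2 ≤ n then ker (g i) else D i
  have hG₂ : ∀ i, i + 2 ≤ n → G₂ i = ker (g i) := fun i hi => if_pos hi
  have hG : ∀ i, IsCompl (G₁ i) (G₂ i) := by
    intro i
    by_cases hi : i + 2 ≤ n
    · rw [hG₂ i hi]
      cases i with
      | zero => exact hC.symm
      | succ j => exact (hcompl j (by omega)).1
    · have : G₂ i = D i := if_neg hi
      exact this ▸ hD i
  refine ⟨G₁, G₂, fun i _ => hG i, fun i hi => ?_⟩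
  have h₁ : IsCompl (G₁ i) (ker (g i)) := hG₂ i hi ▸ hG i
  have h₂ : IsCompl (G₂ (i + 1)) (ker (g' i)) := (hker i hi).2 ▸ (hG (i + 1)).symm
  refine ⟨map_eq_range_of_isCompl_ker h₁, injOn_of_disjoint_ker subset_rfl h₁.disjoint, ?_,
    injOn_of_disjoint_ker subset_rfl h₂.disjoint, ?_, ?_⟩
  · rw [map_eq_range_of_isCompl_ker h₂, hG₂ i hi, (hker i hi).1]
  · rw [hG₂ i hi]
    exact le_ker_iff_map.1 le_rfl
  · exact le_ker_iff_map.1 (hker i hi).2.ge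
end

section
/- Let R be a commutative local ring with maximal ideal 𝔪 and residue field k = R/𝔪, let s ∈ 𝔪, n ≥ 1, and let G_1,…,G_n be finite free R-modules of rank m with R-linear maps g_i : G_i → G_{i+1}, g'_i : G_{i+1} → G_i (1 ≤ i ≤ n−1) satisfying g_i ∘ g'_i = g'_i ∘ g_i = s·id. Denote by ḡ_i, ḡ'_i the induced k-linear maps on G_i ⊗_R k. Assume: ker ḡ_i = range ḡ'_i and ker ḡ'_i = range ḡ_i for all 1 ≤ i ≤ n−1; and for all 1 ≤ i ≤ n−2, range ḡ_i is a complement of ker ḡ_{i+1} in G_{i+1} ⊗_R k and range ḡ'_{i+1} is a complement of ker ḡ'_i in G_{i+1} ⊗_R k. Then there exist free submodules G'_i, G''_i of G_i for each 1 ≤ i ≤ n such that G_i = G'_i ⊕ G''_i is an internal direct sum, g_i(G'_i) ⊆ G'_{i+1}, g_i(G''_i) ⊆ G''_{i+1}, g'_i(G'_{i+1}) ⊆ G'_i, g'_i(G''_{i+1}) ⊆ G''_i, and the map G'_i → G'_{i+1} induced by g_i and the map G''_{i+1} → G''_i induced by g'_i are isomorphisms for all 1 ≤ i ≤ n−1.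 -/
/-!
Statement 5 (Lemma 2.4 of Osserman, "Linked Hom spaces", over a local ring).
The chain `G_1, …, G_n` of the paper is indexed here by `0, …, n-1`.
-/

open LinearMap Module TensorProduct

section LinkedChain

variable {R : Type*}

/-- An element of the `N`-th term of a chain can be pushed down along the maps `f i`. -/
theorem exists_descending_sequence {G : ℕ → Type*} [∀ i, Zero (G i)] (f : ∀ i, G (i + 1) → G i)
    (N : ℕ) (x : G N) :
    ∃ w : ∀ i, G i, w N = x ∧ ∀ i < N, w i = f i (w (i + 1)) := by
  induction N with
  | zero => exact ⟨Function.update (fun _ ↦ 0) 0 x, by simp, by simp⟩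
  | succ N ih =>
    obtain ⟨w, hw, hstep⟩ := ih (f N x)
    refine ⟨Function.update w (N + 1) x, by simp, fun i hi ↦ ?_⟩
    rcases Nat.lt_succ_iff_lt_or_eq.mp hi with h | rfl
    · rw [Function.update_of_ne (by omega), Function.update_of_ne (by omega), hstep i h]
    · rw [Function.update_of_ne (by omega), Function.update_self, hw]

/-- A linear map carries a spanning family of a complement of its kernel to a spanning family of
its range. -/
theorem span_range_comp_eq_range [Ring R] {V W ι : Type*} [AddCommGroup V] [AddCommGroup W]
    [Module R V] [Module R W] {f : V →ₗ[R] W} {v : ι → V}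
    (h : Codisjoint (Submodule.span R (Set.range v)) (ker f)) :
    Submodule.span R (Set.range (f ∘ v)) = range f := by
  rw [Set.range_comp, Submodule.span_image, LinearMap.range_eq_map, ← h.eq_top,
    Submodule.map_sup, LinearMap.le_ker_iff_map.mp le_rfl, sup_bot_eq]

/-- If `f` carries a family `v` to a linearly independent family, then it restricts to a bijection
between the spans. -/
theorem bijective_restrict_span [Ring R] {M N ι : Type*} [AddCommGroup M] [AddCommGroup N]
    [Module R M] [Module R N] {f : M →ₗ[R] N} {v : ι → M} {w : ι → N} (hw : w = f ∘ v)
    (hli : LinearIndependent R w)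
    (h : ∀ x ∈ Submodule.span R (Set.range v), f x ∈ Submodule.span R (Set.range w)) :
    Function.Bijective (f.restrict h) := by
  subst hw
  constructor
  · rw [← LinearMap.ker_eq_bot, LinearMap.ker_eq_bot']
    rintro ⟨x, hx⟩ hfx
    have := Submodule.disjoint_def.mp (Submodule.range_ker_disjoint hli) x hx
      (by simpa using congrArg Subtype.val hfx)
    simpa using this
  · rintro ⟨y, hy⟩
    rw [Set.range_comp, Submodule.span_image] at hy
    obtain ⟨x, hx, rfl⟩ := hy
    exact ⟨⟨x, hx⟩, rfl⟩

/-- If `f ∘ f' = s • id`, then `f` maps the span of `f' ∘ v` into the span of `v`. -/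
theorem map_mem_span_of_comp_eq_smul [CommRing R] {M N ι : Type*} [AddCommGroup M]
    [AddCommGroup N] [Module R M] [Module R N] {f : M →ₗ[R] N} {f' : N →ₗ[R] M} {s : R}
    (hs : f.comp f' = s • LinearMap.id) {v : ι → N} {w : ι → M} (hw : w = f' ∘ v) :
    ∀ x ∈ Submodule.span R (Set.range w), f x ∈ Submodule.span R (Set.range v) := by
  subst hw
  intro x hx
  rw [Set.range_comp, Submodule.span_image] at hx
  obtain ⟨y, hy, rfl⟩ := hx
  have := LinearMap.congr_fun hs y
  simp only [LinearMap.comp_apply, LinearMap.smul_apply, LinearMap.id_apply] at this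
  rw [this]
  exact Submodule.smul_mem _ _ hy

/-- The image of the span of `v` under `f` lies in the span of `f ∘ v`. -/
theorem map_mem_span_comp [Ring R] {M N ι : Type*} [AddCommGroup M] [AddCommGroup N]
    [Module R M] [Module R N] {f : M →ₗ[R] N} {v : ι → M} {w : ι → N} (hw : w = f ∘ v) :
    ∀ x ∈ Submodule.span R (Set.range v), f x ∈ Submodule.span R (Set.range w) := by
  subst hw
  intro x hx
  rw [Set.range_comp, Submodule.span_image]
  exact Submodule.mem_map_of_mem hx

/-- Two families whose reductions are bases of complementary subspaces of `k ⊗ M` are bases of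
complementary submodules of `M`. -/
theorem linearIndependent_and_isCompl_span_of_residueField [CommRing R] [IsLocalRing R]
    {M ι κ : Type*} [AddCommGroup M] [Module R M] [Module.Free R M] [Module.Finite R M]
    {v : ι → M} {w : κ → M}
    (hv : LinearIndependent (IsLocalRing.ResidueField R)
      (TensorProduct.mk R (IsLocalRing.ResidueField R) M 1 ∘ v))
    (hw : LinearIndependent (IsLocalRing.ResidueField R)
      (TensorProduct.mk R (IsLocalRing.ResidueField R) M 1 ∘ w))
    (hc : IsCompl
      (Submodule.span (IsLocalRing.ResidueField R)
        (Set.range (TensorProduct.mk R (IsLocalRing.ResidueField R) M 1 ∘ v)))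
      (Submodule.span (IsLocalRing.ResidueField R)
        (Set.range (TensorProduct.mk R (IsLocalRing.ResidueField R) M 1 ∘ w)))) :
    LinearIndependent R v ∧ LinearIndependent R w ∧
      IsCompl (Submodule.span R (Set.range v)) (Submodule.span R (Set.range w)) := by
  have hfp : Module.FinitePresentation R M := Module.finitePresentation_of_projective R M
  have hcomp : TensorProduct.mk R (IsLocalRing.ResidueField R) M 1 ∘ Sum.elim v w =
      Sum.elim (TensorProduct.mk R (IsLocalRing.ResidueField R) M 1 ∘ v)
        (TensorProduct.mk R (IsLocalRing.ResidueField R) M 1 ∘ w) := Sum.comp_elim _ _ _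
  obtain ⟨b, hb⟩ := Module.exists_basis_of_basis_baseChange (R := R) (Sum.elim v w)
    (by rw [hcomp]; exact hv.sum_type hw hc.disjoint)
    (by rw [hcomp, Set.Sum.elim_range, Submodule.span_union, hc.sup_eq_top])
    (Module.Flat.rTensor_preserves_injective_linearMap _ Subtype.val_injective)
  have hb' : (b : ι ⊕ κ → M) = Sum.elim v w := funext hb
  have hli := b.linearIndependent
  have hsp := b.span_eq
  rw [hb'] at hli hsp
  have h := linearIndependent_sum.mp hli
  rw [Set.Sum.elim_range, Submodule.span_union] at hsp
  exact ⟨h.1, h.2.1, h.2.2, codisjoint_iff.mpr hsp⟩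

/-- Every subspace of a finite-dimensional vector space has a complement spanned by a finite
linearly independent family. -/
theorem exists_linearIndependent_isCompl_span {k V : Type*} [Field k] [AddCommGroup V]
    [Module k V] [Module.Finite k V] (K : Submodule k V) :
    ∃ (d : ℕ) (u : Fin d → V),
      LinearIndependent k u ∧ IsCompl (Submodule.span k (Set.range u)) K := by
  obtain ⟨C, hC⟩ := K.exists_isCompl
  let b := Module.finBasis k C
  refine ⟨_, C.subtype ∘ b, b.linearIndependent.map' C.subtype C.ker_subtype, ?_⟩
  rw [Set.range_comp, Submodule.span_image, b.span_eq, Submodule.map_top, Submodule.range_subtype]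
  exact hC.symm

/-- Every subspace of `k ⊗ M` has a complement with a basis that lifts to `M`. -/
theorem exists_linearIndependent_isCompl_span_residueField [CommRing R] [IsLocalRing R]
    {M : Type*} [AddCommGroup M] [Module R M] [Module.Finite R M]
    (K : Submodule (IsLocalRing.ResidueField R) (IsLocalRing.ResidueField R ⊗[R] M)) :
    ∃ (d : ℕ) (v : Fin d → M),
      LinearIndependent (IsLocalRing.ResidueField R)
        (TensorProduct.mk R (IsLocalRing.ResidueField R) M 1 ∘ v) ∧
      IsCompl (Submodule.span (IsLocalRing.ResidueField R)
        (Set.range (TensorProduct.mk R (IsLocalRing.ResidueField R) M 1 ∘ v))) K := by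
  obtain ⟨d, u, hu, hc⟩ := exists_linearIndependent_isCompl_span K
  obtain ⟨v, rfl⟩ := (TensorProduct.mk_surjective R M (IsLocalRing.ResidueField R)
    IsLocalRing.residue_surjective).comp_left u
  exact ⟨d, v, hu, hc⟩

/-- Base change along `R → k` commutes with reducing a family of vectors. -/
theorem mk_one_comp_baseChange [CommRing R] {A M N ι : Type*} [CommRing A] [Algebra R A]
    [AddCommGroup M] [AddCommGroup N] [Module R M] [Module R N] (f : M →ₗ[R] N) (v : ι → M) :
    TensorProduct.mk R A N 1 ∘ (f ∘ v) = f.baseChange A ∘ (TensorProduct.mk R A M 1 ∘ v) := by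
  ext; simp

end LinkedChain

theorem exists_decomposition_of_linked_chain_local (R : Type*) [CommRing R] [IsLocalRing R]
    (s : R) (hs : s ∈ IsLocalRing.maximalIdeal R)
    (n : ℕ) (hn : 1 ≤ n) (m : ℕ)
    (G : ℕ → Type*) [∀ i, AddCommGroup (G i)] [∀ i, Module R (G i)]
    (hGfree : ∀ i, i < n → Module.Free R (G i))
    (hGfin : ∀ i, i < n → Module.Finite R (G i))
    (hGm : ∀ i, i < n → finrank R (G i) = m)
    (g : ∀ i, G i →ₗ[R] G (i + 1)) (g' : ∀ i, G (i + 1) →ₗ[R] G i)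
    (hg : ∀ i, i + 2 ≤ n → (g i).comp (g' i) = s • LinearMap.id ∧
      (g' i).comp (g i) = s • LinearMap.id)
    -- over the residue field `k = R/𝔪`, kernels of the reduced maps equal images:
    (hker : ∀ i, i + 2 ≤ n →
      ker ((g i).baseChange (IsLocalRing.ResidueField R)) =
        range ((g' i).baseChange (IsLocalRing.ResidueField R)) ∧
      ker ((g' i).baseChange (IsLocalRing.ResidueField R)) =
        range ((g i).baseChange (IsLocalRing.ResidueField R)))
    -- and complementarity for the reduced maps:
    (hcompl : ∀ i, i + 3 ≤ n →
      IsCompl (range ((g i).baseChange (IsLocalRing.ResidueField R)))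
        (ker ((g (i + 1)).baseChange (IsLocalRing.ResidueField R))) ∧
      IsCompl (range ((g' (i + 1)).baseChange (IsLocalRing.ResidueField R)))
        (ker ((g' i).baseChange (IsLocalRing.ResidueField R)))) :
    ∃ G₁ G₂ : ∀ i, Submodule R (G i),
      (∀ i, i < n →
        Module.Free R (G₁ i) ∧ Module.Free R (G₂ i) ∧ IsCompl (G₁ i) (G₂ i)) ∧
      (∀ i, ∀ _ : i + 2 ≤ n,
        ∃ (h₁ : ∀ x ∈ G₁ i, g i x ∈ G₁ (i + 1)) (_ : ∀ x ∈ G₂ i, g i x ∈ G₂ (i + 1))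
          (_ : ∀ x ∈ G₁ (i + 1), g' i x ∈ G₁ i) (h₄ : ∀ x ∈ G₂ (i + 1), g' i x ∈ G₂ i),
          Function.Bijective ((g i).restrict h₁) ∧
          Function.Bijective ((g' i).restrict h₄)) := by
  set k := IsLocalRing.ResidueField R
  obtain rfl | ⟨N, rfl⟩ : n = 1 ∨ ∃ N, n = N + 2 := by
    rcases n with _ | _ | N
    · omega
    · exact Or.inl rfl
    · exact Or.inr ⟨N, rfl⟩
  · refine ⟨fun _ ↦ ⊤, fun _ ↦ ⊥, fun i hi ↦ ?_, fun i hi ↦ by omega⟩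
    have := hGfree i hi
    exact ⟨Module.Free.of_equiv (Submodule.topEquiv (R := R) (M := G i)).symm, inferInstance,
      isCompl_top_bot⟩
  have hfin₀ := hGfin 0 (by omega)
  have hfin₁ := hGfin (N + 1) (by omega)
  obtain ⟨d, v₀, hv₀, hv₀c⟩ :=
    exists_linearIndependent_isCompl_span_residueField (ker ((g 0).baseChange k))
  obtain ⟨e, w₀, hw₀, hw₀c⟩ :=
    exists_linearIndependent_isCompl_span_residueField (ker ((g' N).baseChange k))
  let v : ∀ i, Fin d → G i := fun i ↦ Nat.rec v₀ (fun i u ↦ g i ∘ u) i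
  obtain ⟨w, hwN, hw⟩ := exists_descending_sequence (G := fun i ↦ Fin e → G i)
    (fun i u ↦ g' i ∘ u) (N + 1) w₀
  let vk : ∀ i, Fin d → k ⊗[R] G i := fun i ↦ TensorProduct.mk R k (G i) 1 ∘ v i
  let wk : ∀ i, Fin e → k ⊗[R] G i := fun i ↦ TensorProduct.mk R k (G i) 1 ∘ w i
  have hvk : ∀ i, vk (i + 1) = (g i).baseChange k ∘ vk i := fun i ↦
    mk_one_comp_baseChange (g i) (v i)
  have hwk : ∀ i < N + 1, wk i = (g' i).baseChange k ∘ wk (i + 1) := fun i hi ↦ by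
    simp only [wk, hw i hi]
    exact mk_one_comp_baseChange (g' i) (w (i + 1))
  have hV : ∀ i, i < N + 1 → LinearIndependent k (vk i) ∧
      IsCompl (Submodule.span k (Set.range (vk i))) (ker ((g i).baseChange k)) := by
    intro i
    induction i with
    | zero => exact fun _ ↦ ⟨hv₀, hv₀c⟩
    | succ i ih =>
      intro hi
      obtain ⟨h₁, h₂⟩ := ih (by omega)
      rw [hvk, span_range_comp_eq_range h₂.codisjoint]
      exact ⟨h₁.map h₂.disjoint, (hcompl i (by omega)).1⟩
  have hW : ∀ i, i ≤ N → LinearIndependent k (wk (i + 1)) ∧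
      IsCompl (Submodule.span k (Set.range (wk (i + 1)))) (ker ((g' i).baseChange k)) := by
    intro i hi
    induction hi using Nat.decreasingInduction with
    | self =>
      simp only [wk, hwN]
      exact ⟨hw₀, hw₀c⟩
    | of_succ i hi ih =>
      obtain ⟨h₁, h₂⟩ := ih
      rw [hwk (i + 1) (by omega), span_range_comp_eq_range h₂.codisjoint]
      exact ⟨h₁.map h₂.disjoint, (hcompl i (by omega)).2⟩
  have hmain : ∀ i, i < N + 2 → LinearIndependent R (v i) ∧ LinearIndependent R (w i) ∧
      IsCompl (Submodule.span R (Set.range (v i))) (Submodule.span R (Set.range (w i))) := by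
    intro i hi
    have hfree := hGfree i hi
    have hfin := hGfin i hi
    suffices LinearIndependent k (vk i) ∧ LinearIndependent k (wk i) ∧
        IsCompl (Submodule.span k (Set.range (vk i))) (Submodule.span k (Set.range (wk i))) from
      linearIndependent_and_isCompl_span_of_residueField this.1 this.2.1 this.2.2
    rcases Nat.lt_succ_iff_lt_or_eq.mp hi with h | rfl
    · obtain ⟨h₁, h₂⟩ := hV i h
      obtain ⟨h₃, h₄⟩ := hW i (by omega)
      rw [hwk i h, span_range_comp_eq_range h₄.codisjoint, ← (hker i (by omega)).1]
      exact ⟨h₁, h₃.map h₄.disjoint, h₂⟩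
    · obtain ⟨h₁, h₂⟩ := hV N (by omega)
      obtain ⟨h₃, h₄⟩ := hW N le_rfl
      rw [hvk N, span_range_comp_eq_range h₂.codisjoint, ← (hker N le_rfl).2]
      exact ⟨h₁.map h₂.disjoint, h₃, h₄.symm⟩
  refine ⟨fun i ↦ Submodule.span R (Set.range (v i)), fun i ↦ Submodule.span R (Set.range (w i)),
    fun i hi ↦ ?_, fun i hi ↦ ?_⟩
  · obtain ⟨h₁, h₂, h₃⟩ := hmain i hi
    exact ⟨Module.Free.of_basis (Basis.span h₁), Module.Free.of_basis (Basis.span h₂), h₃⟩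
  · have hvi : v (i + 1) = g i ∘ v i := rfl
    have hwi : w i = g' i ∘ w (i + 1) := hw i (by omega)
    exact ⟨map_mem_span_comp hvi, map_mem_span_of_comp_eq_smul (hg i hi).1 hwi,
      map_mem_span_of_comp_eq_smul (hg i hi).2 hvi, map_mem_span_comp hwi,
      bijective_restrict_span hvi (hmain (i + 1) (by omega)).1 _,
      bijective_restrict_span hwi (hmain i (by omega)).2.1 _⟩
end

section
/- Let k be a field, n ≥ 1, and let G_1,…,G_n be finite-dimensional k-vector spaces of dimension m with linear maps g_i : G_i → G_{i+1}, g'_i : G_{i+1} → G_i (1 ≤ i ≤ n−1) satisfying: ker g_i = range g'_i and ker g'_i = range g_i for all i; and for all 1 ≤ i ≤ n−2, range g_i is a complement of ker g_{i+1} in G_{i+1} and range g'_{i+1} is a complement of ker g'_i in G_{i+1}. Let W' be a subspace of G_1 complementary to ker g_1 and W'' a subspace of G_n complementary to ker g'_{n−1}. Then for every 1 ≤ i ≤ n, the subspaces (g_{i−1} ∘ ⋯ ∘ g_1)(W') and (g'_i ∘ ⋯ ∘ g'_{n−1})(W'') (with the empty composite being the identity) are complementary in G_i. -/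
/-!
Statement 7: the images of complements `W' ⊆ G_1` of `ker g_1` and
`W'' ⊆ G_n` of `ker g'_{n-1}` under the composites of the `g`- and `g'`-maps
are complementary in each `G_i`.  The chain `G_1, …, G_n` of the paper is
indexed here by `0, …, n-1`; we write the length as `n = t + 2` (for the
hypotheses of the statement to refer to the maps `g_1` and `g'_{n-1}`, the
chain must have length at least `2`).
-/

open LinearMap Module

/-- The composite `g_{j-1} ∘ ⋯ ∘ g_i : G i →ₗ G j` (the identity for `i = j`). -/
def gComp {k : Type*} [Semiring k] {G : ℕ → Type*}
    [∀ i, AddCommMonoid (G i)] [∀ i, Module k (G i)]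
    (g : ∀ i, G i →ₗ[k] G (i + 1)) : ∀ {i j : ℕ}, i ≤ j → (G i →ₗ[k] G j) :=
  fun {i j} h =>
    Nat.leRec (motive := fun m _ => G i →ₗ[k] G m) LinearMap.id
      (fun m _ acc => (g m).comp acc) h

/-- The composite `g'_i ∘ ⋯ ∘ g'_{j-1} : G j →ₗ G i` (the identity for `i = j`). -/
def g'Comp {k : Type*} [Semiring k] {G : ℕ → Type*}
    [∀ i, AddCommMonoid (G i)] [∀ i, Module k (G i)]
    (g' : ∀ i, G (i + 1) →ₗ[k] G i) : ∀ {i j : ℕ}, i ≤ j → (G j →ₗ[k] G i) :=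
  fun {i j} h =>
    Nat.leRec (motive := fun m _ => G m →ₗ[k] G i) LinearMap.id
      (fun m _ acc => acc.comp (g' m)) h

section

variable {k : Type*} [Semiring k] {G : ℕ → Type*} [∀ i, AddCommMonoid (G i)]
  [∀ i, Module k (G i)]

@[simp]
theorem gComp_self (g : ∀ i, G i →ₗ[k] G (i + 1)) {i : ℕ} (h : i ≤ i) :
    gComp g h = LinearMap.id :=
  Nat.leRec_self ..

theorem gComp_succ (g : ∀ i, G i →ₗ[k] G (i + 1)) {i j : ℕ} (h : i ≤ j) (h' : i ≤ j + 1) :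
    gComp g h' = (g j).comp (gComp g h) :=
  Nat.leRec_succ ..

@[simp]
theorem g'Comp_self (g' : ∀ i, G (i + 1) →ₗ[k] G i) {i : ℕ} (h : i ≤ i) :
    g'Comp g' h = LinearMap.id :=
  Nat.leRec_self ..

theorem g'Comp_succ (g' : ∀ i, G (i + 1) →ₗ[k] G i) {i j : ℕ} (h : i ≤ j) (h' : i ≤ j + 1) :
    g'Comp g' h' = (g'Comp g' h).comp (g' j) :=
  Nat.leRec_succ ..

/-- The lowest map of the composite can be split off. -/
theorem g'Comp_eq_comp (g' : ∀ i, G (i + 1) →ₗ[k] G i) {i j : ℕ} (h : i + 1 ≤ j) (h' : i ≤ j) :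
    g'Comp g' h' = (g' i).comp (g'Comp g' h) := by
  induction j, h using Nat.le_induction with
  | base => rw [g'Comp_succ g' le_rfl, g'Comp_self, g'Comp_self, id_comp, comp_id]
  | succ j hj ih =>
    rw [g'Comp_succ g' (Nat.le_of_succ_le hj), g'Comp_succ g' hj, ih, comp_assoc]

end

theorem isCompl_map_gComp_map_g'Comp (k : Type*) [Field k] (t : ℕ) (m : ℕ)
    (G : ℕ → Type*) [∀ i, AddCommGroup (G i)] [∀ i, Module k (G i)]
    (hGfin : ∀ i, i < t + 2 → FiniteDimensional k (G i))
    (hGm : ∀ i, i < t + 2 → finrank k (G i) = m)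
    (g : ∀ i, G i →ₗ[k] G (i + 1)) (g' : ∀ i, G (i + 1) →ₗ[k] G i)
    -- kernels equal images:
    (hker : ∀ i, i + 2 ≤ t + 2 → ker (g i) = range (g' i) ∧ ker (g' i) = range (g i))
    -- complementarity:
    (hcompl : ∀ i, i + 3 ≤ t + 2 →
      IsCompl (range (g i)) (ker (g (i + 1))) ∧
      IsCompl (range (g' (i + 1))) (ker (g' i)))
    -- `W'` is a complement of `ker g_1` in `G_1`:
    (W' : Submodule k (G 0)) (hW' : IsCompl W' (ker (g 0)))
    -- `W''` is a complement of `ker g'_{n-1}` in `G_n`: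
    (W'' : Submodule k (G (t + 1))) (hW'' : IsCompl W'' (ker (g' t))) :
    ∀ i (hi : i < t + 2),
      IsCompl (W'.map (gComp g (Nat.zero_le i)))
        (W''.map (g'Comp g' (show i ≤ t + 1 by omega))) := by
  have map_eq_g : ∀ i, IsCompl (W'.map (gComp g (Nat.zero_le i))) (ker (g i)) →
      W'.map (gComp g (Nat.zero_le (i + 1))) = range (g i) := fun i h => by
    rw [gComp_succ g (Nat.zero_le i), Submodule.map_comp]
    exact Submodule.map_eq_range_iff.2 h.codisjoint
  have map_eq_g' : ∀ i (hi : i ≤ t),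
      IsCompl (W''.map (g'Comp g' (Nat.succ_le_succ hi))) (ker (g' i)) →
      W''.map (g'Comp g' (Nat.le_succ_of_le hi)) = range (g' i) := fun i hi h => by
    rw [g'Comp_eq_comp g' (Nat.succ_le_succ hi), Submodule.map_comp]
    exact Submodule.map_eq_range_iff.2 h.codisjoint
  have isCompl_g : ∀ i, i ≤ t → IsCompl (W'.map (gComp g (Nat.zero_le i))) (ker (g i)) := by
    intro i
    induction i with
    | zero => intro _; simpa using hW'
    | succ i ih =>
      intro hi
      rw [map_eq_g i (ih (by omega))]
      exact (hcompl i (by omega)).1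
  have isCompl_g' : ∀ i (hi : i ≤ t),
      IsCompl (W''.map (g'Comp g' (Nat.succ_le_succ hi))) (ker (g' i)) := by
    intro i hi
    induction hi using Nat.decreasingInduction with
    | self => simpa using hW''
    | of_succ i hi ih =>
      rw [map_eq_g' (i + 1) hi ih]
      exact (hcompl i (by omega)).2
  intro i hi
  obtain hi | rfl : i ≤ t ∨ i = t + 1 := by omega
  · rw [map_eq_g' i hi (isCompl_g' i hi), ← (hker i (by omega)).1]
    exact isCompl_g i hi
  · rw [map_eq_g t (isCompl_g t le_rfl), ← (hker t le_rfl).2, g'Comp_self, Submodule.map_id]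
    exact hW''.symm
end
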